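/- arXiv:0710.1870 — 5 statements merged into one kernel-verified Lean document; each statement's English description precedes it below -/
import Mathlib

section
/- Let G and G' be graphs with n ≥ 3 nodes and weights in a set X. If the distributions of subtriangles coincide, T_{G'} = T_G, then the multiset of all edge weights g_{i,j} over unordered pairs {i,j} with i ≠ j of G equals the corresponding multiset of edge weights of G', and the multiset of all node weights w_1, …, w_n of G equals the multiset of node weights w'_1, …, w'_n of G'. (Indeed, the first components of the pairs appearing in T_G list each edge weight g_S exactly n−2 times, and the second components list each node weight w_i exactly binomial(n−1,2) times.) -/
/-- Subtriangle of a weighted graph on pairwise distinct nodes `i, j, k`. -/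
def subtriangle {n : ℕ} {X : Type*} (g : Sym2 (Fin n) → X) (i j k : Fin n) :
    Multiset (X × X) :=
  {(g s(i, j), g s(k, k)), (g s(i, k), g s(j, j)), (g s(j, k), g s(i, i))}

/-- The distribution of subtriangles of a graph. -/
def triangleDist {n : ℕ} {X : Type*} (g : Sym2 (Fin n) → X) :
    Multiset (Multiset (X × X)) :=
  ((Finset.univ : Finset (Fin n × Fin n × Fin n)).filter
      (fun p => p.1 < p.2.1 ∧ p.2.1 < p.2.2)).val.map
    (fun p => subtriangle g p.1 p.2.1 p.2.2)

/-- The multiset of edge weights `g{i,j}` over unordered pairs `{i,j}`, `i ≠ j`. -/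
def edgeDist {n : ℕ} {X : Type*} (g : Sym2 (Fin n) → X) : Multiset X :=
  ((Finset.univ : Finset (Fin n × Fin n)).filter (fun p => p.1 < p.2)).val.map
    (fun p => g s(p.1, p.2))

/-- The multiset of node weights `w i = g{i,i}`. -/
def nodeDist {n : ℕ} {X : Type*} (g : Sym2 (Fin n) → X) : Multiset X :=
  (Finset.univ : Finset (Fin n)).val.map (fun i => g s(i, i))

/-- Multisets are determined by the sums of natural-valued functions over them. -/
theorem Multiset.eq_of_forall_sum_map_eq {X : Type*} {s t : Multiset X}
    (h : ∀ f : X → ℕ, (s.map f).sum = (t.map f).sum) : s = t := by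
  classical
  have key (x : X) (u : Multiset X) :
      (u.map (fun y => if x = y then 1 else 0)).sum = u.count x := by
    induction u using Multiset.induction_on with
    | empty => simp
    | cons a u ih => simp [ih, Multiset.count_cons, add_comm]
  ext x
  rw [← key, ← key, h]

/-- A sum over subtriangles, rewritten as a sum over an edge and a node outside it. -/
theorem sum_triangleDist {n : ℕ} {X : Type*} (g : Sym2 (Fin n) → X) (φ : X × X → ℕ) :
    ((triangleDist g).map (fun t => (t.map φ).sum)).sum =
      ∑ a, ∑ b, ∑ c, if a < b ∧ c ≠ a ∧ c ≠ b then φ (g s(a, b), g s(c, c)) else 0 := by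
  have hsum : ((triangleDist g).map (fun t => (t.map φ).sum)).sum =
      ∑ a, ∑ b, ∑ c, ((if a < b ∧ b < c then φ (g s(a, b), g s(c, c)) else 0) +
        (if a < b ∧ b < c then φ (g s(a, c), g s(b, b)) else 0) +
        (if a < b ∧ b < c then φ (g s(b, c), g s(a, a)) else 0)) := by
    rw [triangleDist, Multiset.map_map]
    change ∑ p ∈ Finset.univ.filter
      (fun p : Fin n × Fin n × Fin n => p.1 < p.2.1 ∧ p.2.1 < p.2.2),
      ((subtriangle g p.1 p.2.1 p.2.2).map φ).sum = _
    rw [Finset.sum_filter, Fintype.sum_prod_type]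
    refine Finset.sum_congr rfl fun a _ => ?_
    rw [Fintype.sum_prod_type]
    refine Finset.sum_congr rfl fun b _ => Finset.sum_congr rfl fun c _ => ?_
    split_ifs <;> simp [subtriangle, add_assoc]
  have hmid : (∑ a, ∑ b, ∑ c, if a < b ∧ b < c then φ (g s(a, c), g s(b, b)) else 0) =
      ∑ a, ∑ b, ∑ c, if a < c ∧ c < b then φ (g s(a, b), g s(c, c)) else 0 :=
    Finset.sum_congr rfl fun a _ => Finset.sum_comm
  have hlow : (∑ a, ∑ b, ∑ c, if a < b ∧ b < c then φ (g s(b, c), g s(a, a)) else 0) =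
      ∑ a, ∑ b, ∑ c, if c < a ∧ a < b then φ (g s(a, b), g s(c, c)) else 0 := by
    rw [Finset.sum_comm]
    exact Finset.sum_congr rfl fun a _ => Finset.sum_comm
  rw [hsum]
  simp only [Finset.sum_add_distrib]
  rw [hmid, hlow]
  simp only [← Finset.sum_add_distrib]
  refine Finset.sum_congr rfl fun a _ => Finset.sum_congr rfl fun b _ =>
    Finset.sum_congr rfl fun c _ => ?_
  split_ifs <;> omega

theorem card_filter_ne_and_ne {n : ℕ} {a b : Fin n} (hab : a ≠ b) :
    (Finset.univ.filter (fun c => c ≠ a ∧ c ≠ b)).card = n - 2 := by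
  have : Finset.univ.filter (fun c => c ≠ a ∧ c ≠ b) = ({a, b} : Finset (Fin n))ᶜ := by
    ext c
    simp
  rw [this, Finset.card_compl, Finset.card_pair hab, Fintype.card_fin]

theorem sum_triangleDist_fst {n : ℕ} {X : Type*} (g : Sym2 (Fin n) → X) (f : X → ℕ) :
    ((triangleDist g).map (fun t => (t.map (fun p => f p.1)).sum)).sum =
      (n - 2) * ((edgeDist g).map f).sum := by
  have hedge : ((edgeDist g).map f).sum = ∑ a, ∑ b, if a < b then f (g s(a, b)) else 0 := by
    rw [edgeDist, Multiset.map_map]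
    change ∑ p ∈ Finset.univ.filter (fun p : Fin n × Fin n => p.1 < p.2), f (g s(p.1, p.2)) = _
    rw [Finset.sum_filter, Fintype.sum_prod_type]
  rw [sum_triangleDist, hedge, Finset.mul_sum]
  refine Finset.sum_congr rfl fun a _ => ?_
  rw [Finset.mul_sum]
  refine Finset.sum_congr rfl fun b _ => ?_
  by_cases hab : a < b
  · simp only [hab, true_and, if_true]
    rw [← Finset.sum_filter, Finset.sum_const, card_filter_ne_and_ne hab.ne, smul_eq_mul]
  · simp [hab]

theorem two_mul_sum_triangleDist_snd {n : ℕ} {X : Type*} (g : Sym2 (Fin n) → X) (f : X → ℕ) :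
    2 * ((triangleDist g).map (fun t => (t.map (fun p => f p.2)).sum)).sum =
      (n - 1) * (n - 2) * ((nodeDist g).map f).sum := by
  have hnode : ((nodeDist g).map f).sum = ∑ c, f (g s(c, c)) := by
    rw [nodeDist, Multiset.map_map]
    rfl
  have hsymm : (∑ a, ∑ b, ∑ c, if a < b ∧ c ≠ a ∧ c ≠ b then f (g s(c, c)) else 0) =
      ∑ a, ∑ b, ∑ c, if b < a ∧ c ≠ a ∧ c ≠ b then f (g s(c, c)) else 0 := by
    rw [Finset.sum_comm]
    simp only [and_comm]
  have hdistinct : 2 * ((triangleDist g).map (fun t => (t.map (fun p => f p.2)).sum)).sum =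
      ∑ c, ∑ a, ∑ b, if a ≠ c ∧ b ≠ a ∧ b ≠ c then f (g s(c, c)) else 0 := by
    rw [sum_triangleDist, two_mul]
    nth_rw 2 [hsymm]
    simp only [← Finset.sum_add_distrib]
    rw [Finset.sum_comm]
    rw [Finset.sum_congr rfl fun b _ => Finset.sum_comm, Finset.sum_comm]
    refine Finset.sum_congr rfl fun c _ => Finset.sum_congr rfl fun a _ =>
      Finset.sum_congr rfl fun b _ => ?_
    split_ifs <;> omega
  rw [hdistinct, hnode, Finset.mul_sum]
  refine Finset.sum_congr rfl fun c _ => ?_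
  have hinner (a : Fin n) : (∑ b, if a ≠ c ∧ b ≠ a ∧ b ≠ c then f (g s(c, c)) else 0) =
      if a ≠ c then (n - 2) * f (g s(c, c)) else 0 := by
    by_cases hac : a ≠ c
    · simp only [hac, true_and, if_true, ne_eq, not_false_eq_true]
      rw [← Finset.sum_filter, Finset.sum_const, card_filter_ne_and_ne hac, smul_eq_mul]
    · simp [hac]
  simp only [hinner]
  rw [← Finset.sum_filter, Finset.sum_const, Finset.filter_ne', Finset.card_erase_of_mem
    (Finset.mem_univ c), Finset.card_univ, Fintype.card_fin, smul_eq_mul, mul_assoc]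

/-- If two graphs with `n ≥ 3` nodes have the same distribution of
subtriangles, then they have the same multiset of edge weights and the same
multiset of node weights. -/
theorem edgeDist_nodeDist_of_triangleDist_eq {n : ℕ} {X : Type*} (hn : 3 ≤ n)
    (g g' : Sym2 (Fin n) → X) (h : triangleDist g' = triangleDist g) :
    edgeDist g = edgeDist g' ∧ nodeDist g = nodeDist g' := by
  refine ⟨Multiset.eq_of_forall_sum_map_eq fun f => ?_,
    Multiset.eq_of_forall_sum_map_eq fun f => ?_⟩
  · refine Nat.eq_of_mul_eq_mul_left (show 0 < n - 2 by omega) ?_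
    rw [← sum_triangleDist_fst, ← sum_triangleDist_fst, h]
  · refine Nat.eq_of_mul_eq_mul_left
      (show 0 < (n - 1) * (n - 2) from Nat.mul_pos (by omega) (by omega)) ?_
    rw [← two_mul_sum_triangleDist_snd, ← two_mul_sum_triangleDist_snd, h]
end

section
/- (Partial isomorphism lemma.) Let G be a graph with n ≥ 3 nodes and weights g_{i,j} in a set X, with node weights w_i = g_{i,i}. Write P := { {i,j} : 1 ≤ i < j ≤ n } and E := { S ∈ P : g_T ≠ g_S for all T ∈ P \ {S} }. Let G' be a further graph with n nodes, edge weights g'_{i,j} and node weights w'_i in X, such that T_{G'} = T_G. Then there exists a permutation π of {1,…,n} such that: (1) w_i = w'_{π(i)} for all i ∈ {1,…,n}; (2) g_{i,j} = g'_{π(i),π(j)} for all {i,j} ∈ E; and (3) g_{i,j} = g'_{π(i),π(j)} for all pairwise distinct i, j, k ∈ {1,…,n} with {i,k} ∈ E and {j,k} ∈ E. -/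
/-- The set `E` of edges (unordered pairs of distinct nodes, i.e. elements of
`P`) whose weight differs from the weight of every other element of `P`. -/
def uniqueEdges {n : ℕ} {X : Type*} (g : Sym2 (Fin n) → X) :
    Set (Sym2 (Fin n)) :=
  {S | ¬ S.IsDiag ∧ ∀ T : Sym2 (Fin n), ¬ T.IsDiag → T ≠ S → g T ≠ g S}

section PartialIsomorphism

open Finset

open scoped Classical

variable {n : ℕ} {X : Type*}

theorem subtriangle_swap_left (g : Sym2 (Fin n) → X) (i j k : Fin n) :
    subtriangle g j i k = subtriangle g i j k := by
  simp only [subtriangle, Sym2.eq_swap (a := j) (b := i), Multiset.insert_eq_cons]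
  rw [← Multiset.singleton_add, ← Multiset.singleton_add, ← Multiset.singleton_add,
    ← Multiset.singleton_add]
  abel

theorem subtriangle_swap_right (g : Sym2 (Fin n) → X) (i j k : Fin n) :
    subtriangle g i k j = subtriangle g i j k := by
  simp only [subtriangle, Sym2.eq_swap (a := k) (b := j), Multiset.insert_eq_cons]
  rw [← Multiset.singleton_add, ← Multiset.singleton_add, ← Multiset.singleton_add,
    ← Multiset.singleton_add]
  abel

theorem subtriangle_mem_triangleDist (g : Sym2 (Fin n) → X) {i j k : Fin n}
    (hij : i ≠ j) (hik : i ≠ k) (hjk : j ≠ k) : subtriangle g i j k ∈ triangleDist g := by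
  have key : ∀ a b c : Fin n, a < b → b < c → subtriangle g a b c ∈ triangleDist g := by
    intro a b c hab hbc
    exact Multiset.mem_map.2 ⟨(a, b, c), by simpa using ⟨hab, hbc⟩, rfl⟩
  rcases lt_or_gt_of_ne hij with h1 | h1 <;> rcases lt_or_gt_of_ne hik with h2 | h2 <;>
    rcases lt_or_gt_of_ne hjk with h3 | h3
  · exact key _ _ _ h1 h3
  · rw [← subtriangle_swap_right]; exact key _ _ _ h2 h3
  · exact absurd (h1.trans h3) h2.not_gt
  · rw [← subtriangle_swap_right, ← subtriangle_swap_left]; exact key _ _ _ h2 h1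
  · rw [← subtriangle_swap_left]; exact key _ _ _ h1 h2
  · exact absurd (h3.trans h1) h2.not_gt
  · rw [← subtriangle_swap_left, ← subtriangle_swap_right]; exact key _ _ _ h3 h2
  · rw [← subtriangle_swap_left, ← subtriangle_swap_right, ← subtriangle_swap_left]
    exact key _ _ _ h3 h1

/-- Graphs with the same subtriangles: every triangle of `g` has a matching triangle in `g'`. -/
theorem exists_matching_triangle {g g' : Sym2 (Fin n) → X}
    (h : triangleDist g' = triangleDist g) {i j k : Fin n}
    (hij : i ≠ j) (hik : i ≠ k) (hjk : j ≠ k) :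
    ∃ i' j' k' : Fin n, i' ≠ j' ∧ i' ≠ k' ∧ j' ≠ k' ∧
      g s(i, j) = g' s(i', j') ∧ g s(i, k) = g' s(i', k') ∧ g s(j, k) = g' s(j', k') ∧
      g s(i, i) = g' s(i', i') ∧ g s(j, j) = g' s(j', j') ∧ g s(k, k) = g' s(k', k') := by
  have hm := subtriangle_mem_triangleDist g hij hik hjk
  rw [← h] at hm
  obtain ⟨⟨a, b, c⟩, habc, he⟩ := Multiset.mem_map.1 hm
  simp only [mem_val, mem_filter, mem_univ, true_and] at habc
  obtain ⟨hab, hbc⟩ := habc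
  have hac := (hab.trans hbc).ne
  have hab := hab.ne
  have hbc := hbc.ne
  have e1 : (g s(i, j), g s(k, k)) ∈ subtriangle g' a b c := by rw [he]; simp [subtriangle]
  have aux : ∀ a b c : Fin n, a ≠ b → a ≠ c → b ≠ c →
      subtriangle g' a b c = subtriangle g i j k →
      (g s(i, j), g s(k, k)) = (g' s(a, b), g' s(c, c)) →
      ∃ i' j' k' : Fin n, i' ≠ j' ∧ i' ≠ k' ∧ j' ≠ k' ∧
      g s(i, j) = g' s(i', j') ∧ g s(i, k) = g' s(i', k') ∧ g s(j, k) = g' s(j', k') ∧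
      g s(i, i) = g' s(i', i') ∧ g s(j, j) = g' s(j', j') ∧ g s(k, k) = g' s(k', k') := by
    intro a b c hab hac hbc he e
    simp only [subtriangle, Multiset.insert_eq_cons] at he
    rw [e, Multiset.cons_inj_right, Multiset.cons_eq_cons] at he
    simp only [Multiset.singleton_inj, Multiset.singleton_eq_cons_iff, Prod.mk.injEq] at he e
    rcases he with he | he
    · exact ⟨a, b, c, hab, hac, hbc, by tauto⟩
    · obtain ⟨-, t, ⟨h1, -⟩, h2, -⟩ := he
      refine ⟨b, a, c, hab.symm, hbc, hac, ?_⟩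
      rw [Sym2.eq_swap (a := b) (b := a)]
      tauto
  rw [subtriangle] at e1
  simp only [Multiset.insert_eq_cons, Multiset.mem_cons, Multiset.mem_singleton] at e1
  rcases e1 with e1 | e1 | e1
  · exact aux a b c hab hac hbc he e1
  · exact aux a c b hac hab hbc.symm (by rw [subtriangle_swap_right, he]) e1
  · exact aux b c a hbc hab.symm hac.symm
      (by rw [subtriangle_swap_right, subtriangle_swap_left, he]) e1

theorem sum_distinct_eq_sum_lt (f : Fin n → Fin n → Fin n → ℕ)
    (hf : ∀ i j k, f j i k = f i j k) :
    ∑ i, ∑ j, ∑ k, (if i ≠ j ∧ i ≠ k ∧ j ≠ k then f i j k else 0) =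
      2 * ∑ i, ∑ j, ∑ k, (if i < j ∧ j < k then f i j k + f i k j + f j k i else 0) := by
  have key : ∀ i j k : Fin n, (if i ≠ j ∧ i ≠ k ∧ j ≠ k then f i j k else 0) =
      (if i < j ∧ j < k then f i j k else 0) + (if i < k ∧ k < j then f i j k else 0) +
      (if j < i ∧ i < k then f i j k else 0) + (if j < k ∧ k < i then f i j k else 0) +
      (if k < i ∧ i < j then f i j k else 0) + (if k < j ∧ j < i then f i j k else 0) := by
    intro i j k
    split_ifs <;> omega
  simp only [key, sum_add_distrib]
  have split : ∀ i j k : Fin n, (if i < j ∧ j < k then f i j k + f i k j + f j k i else 0) =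
      (if i < j ∧ j < k then f i j k else 0) + (if i < j ∧ j < k then f i k j else 0) +
      (if i < j ∧ j < k then f j k i else 0) := by
    intro i j k
    split_ifs <;> simp
  simp only [split, sum_add_distrib]
  have c2 : ∑ i, ∑ j, ∑ k, (if i < k ∧ k < j then f i j k else 0) =
      ∑ i, ∑ j, ∑ k, (if i < j ∧ j < k then f i k j else 0) :=
    sum_congr rfl fun i _ => sum_comm
  have c3 : ∑ i, ∑ j, ∑ k, (if j < i ∧ i < k then f i j k else 0) =
      ∑ i, ∑ j, ∑ k, (if i < j ∧ j < k then f i j k else 0) := by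
    rw [sum_comm]; simp only [hf]
  have c5 : ∑ i, ∑ j, ∑ k, (if k < i ∧ i < j then f i j k else 0) =
      ∑ i, ∑ j, ∑ k, (if i < j ∧ j < k then f j k i else 0) := by
    rw [sum_congr rfl fun i _ => sum_comm, sum_comm]
  have c4 : ∑ i, ∑ j, ∑ k, (if j < k ∧ k < i then f i j k else 0) =
      ∑ i, ∑ j, ∑ k, (if i < k ∧ k < j then f i j k else 0) := by
    rw [sum_comm]; simp only [hf]
  have c6 : ∑ i, ∑ j, ∑ k, (if k < j ∧ j < i then f i j k else 0) =
      ∑ i, ∑ j, ∑ k, (if k < i ∧ i < j then f i j k else 0) := by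
    rw [sum_comm]; simp only [hf]
  rw [c6, c4, c5, c3, c2]
  ring

/-- Sums over (opposite edge, node) incidences only depend on the distribution of subtriangles. -/
theorem sum_distinct_congr {g g' : Sym2 (Fin n) → X}
    (h : triangleDist g' = triangleDist g) (F : X → X → ℕ) :
    ∑ i, ∑ j, ∑ k, (if i ≠ j ∧ i ≠ k ∧ j ≠ k then F (g s(i, j)) (g s(k, k)) else 0) =
      ∑ i, ∑ j, ∑ k, (if i ≠ j ∧ i ≠ k ∧ j ≠ k then F (g' s(i, j)) (g' s(k, k)) else 0) := by
  have key : ∀ g : Sym2 (Fin n) → X,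
      ∑ i, ∑ j, ∑ k, (if i ≠ j ∧ i ≠ k ∧ j ≠ k then F (g s(i, j)) (g s(k, k)) else 0) =
      2 * ((triangleDist g).map fun t => (t.map fun p => F p.1 p.2).sum).sum := by
    intro g
    rw [sum_distinct_eq_sum_lt (fun i j k => F (g s(i, j)) (g s(k, k)))
      (fun i j k => by rw [Sym2.eq_swap]), triangleDist, Multiset.map_map]
    change _ = 2 * ∑ p ∈ _, _
    rw [sum_filter, Fintype.sum_prod_type]
    simp only [Fintype.sum_prod_type]
    congr 1
    refine sum_congr rfl fun i _ => sum_congr rfl fun j _ => sum_congr rfl fun k _ => ?_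
    simp [subtriangle, add_assoc]
  rw [key, key, h]

/-- Twice the number of edges of weight `x`. -/
noncomputable def edgeCount (g : Sym2 (Fin n) → X) (x : X) : ℕ :=
  ∑ i, ∑ j, if i ≠ j ∧ g s(i, j) = x then 1 else 0

/-- The number of nodes of weight `c`. -/
noncomputable def nodeCount (g : Sym2 (Fin n) → X) (c : X) : ℕ :=
  ∑ i, if g s(i, i) = c then 1 else 0

/-- The number of incidences between nodes of weight `c` and edges of weight `x`. -/
noncomputable def incidenceCount (g : Sym2 (Fin n) → X) (x c : X) : ℕ :=
  ∑ i, ∑ j, if i ≠ j ∧ g s(i, j) = x ∧ g s(i, i) = c then 1 else 0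

theorem sum_ite_distinct {i j : Fin n} (hij : i ≠ j) (f : Fin n → ℕ) :
    ∑ k, (if i ≠ j ∧ i ≠ k ∧ j ≠ k then f k else 0) + (f i + f j) = ∑ k, f k := by
  have e : ∀ k, f k = (if i ≠ j ∧ i ≠ k ∧ j ≠ k then f k else 0) +
      ((if i = k then f k else 0) + (if j = k then f k else 0)) := by
    intro k
    by_cases h1 : i = k <;> by_cases h2 : j = k <;> simp_all
  rw [sum_congr rfl fun k _ => e k]
  simp [sum_add_distrib]

theorem sum_distinct_edge (g : Sym2 (Fin n) → X) (x : X) :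
    ∑ i, ∑ j, ∑ k : Fin n,
      (if i ≠ j ∧ i ≠ k ∧ j ≠ k then (if g s(i, j) = x then 1 else 0) else 0) =
      (n - 2) * edgeCount g x := by
  rw [edgeCount, mul_sum]
  refine sum_congr rfl fun i _ => ?_
  rw [mul_sum]
  refine sum_congr rfl fun j _ => ?_
  by_cases hij : i = j
  · simp [hij]
  have := sum_ite_distinct hij (fun _ => if g s(i, j) = x then 1 else 0)
  simp only [sum_const, card_univ, Fintype.card_fin, smul_eq_mul] at this
  by_cases hx : g s(i, j) = x
  · simp only [hx, if_true, mul_one] at this ⊢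
    simp only [ne_eq, hij, not_false_eq_true, true_and, and_self, if_true, mul_one] at this ⊢
    omega
  · simp [hx]

theorem sum_distinct_edge_node (g : Sym2 (Fin n) → X) (x c : X) :
    ∑ i, ∑ j, ∑ k : Fin n, (if i ≠ j ∧ i ≠ k ∧ j ≠ k then
      (if g s(i, j) = x ∧ g s(k, k) = c then 1 else 0) else 0) + 2 * incidenceCount g x c =
      edgeCount g x * nodeCount g c := by
  have swap : incidenceCount g x c =
      ∑ i, ∑ j, if i ≠ j ∧ g s(i, j) = x ∧ g s(j, j) = c then 1 else 0 := by
    rw [incidenceCount, sum_comm]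
    refine sum_congr rfl fun i _ => sum_congr rfl fun j _ => ?_
    simp only [Sym2.eq_swap (a := i), ne_comm (a := i)]
  rw [two_mul]
  nth_rw 2 [swap]
  rw [incidenceCount, edgeCount, sum_mul, ← sum_add_distrib, ← sum_add_distrib]
  refine sum_congr rfl fun i _ => ?_
  rw [sum_mul, ← sum_add_distrib, ← sum_add_distrib]
  refine sum_congr rfl fun j _ => ?_
  by_cases hij : i = j
  · simp [hij]
  by_cases hx : g s(i, j) = x
  · have := sum_ite_distinct hij (fun k => if g s(k, k) = c then 1 else 0)
    simpa [nodeCount, hij, hx] using this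
  · simp [hx]

theorem sum_distinct_node (g : Sym2 (Fin n) → X) (c : X) :
    ∑ i, ∑ j, ∑ k : Fin n,
      (if i ≠ j ∧ i ≠ k ∧ j ≠ k then (if g s(k, k) = c then 1 else 0) else 0) =
      (n - 1) * (n - 2) * nodeCount g c := by
  have rot : ∀ f : Fin n → Fin n → Fin n → ℕ,
      ∑ i, ∑ j, ∑ k, f i j k = ∑ k, ∑ i, ∑ j, f i j k := by
    intro f
    rw [sum_congr rfl fun i _ => sum_comm, sum_comm]
  rw [rot, nodeCount, mul_sum]
  refine sum_congr rfl fun k _ => ?_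
  by_cases hc : g s(k, k) = c
  · simp only [hc, if_true, mul_one]
    have inner : ∀ i : Fin n, ∑ j : Fin n, (if i ≠ j ∧ i ≠ k ∧ j ≠ k then 1 else 0) =
        if i ≠ k then n - 2 else 0 := by
      intro i
      by_cases hik : i = k
      · simp [hik]
      have := sum_ite_distinct hik (fun _ => 1)
      simp only [sum_const, card_univ, Fintype.card_fin, smul_eq_mul, mul_one] at this
      have e : ∑ j : Fin n, (if i ≠ j ∧ i ≠ k ∧ j ≠ k then 1 else 0) =
          ∑ j : Fin n, (if i ≠ k ∧ i ≠ j ∧ k ≠ j then 1 else 0) := by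
        refine sum_congr rfl fun j _ => if_congr ?_ rfl rfl
        rw [ne_comm (a := k)]
        tauto
      rw [if_pos hik, e]
      omega
    rw [sum_congr rfl fun i _ => inner i, ← sum_filter, sum_const, filter_ne', card_erase_of_mem
      (mem_univ k), card_univ, Fintype.card_fin, smul_eq_mul]
  · simp [hc]

theorem edgeCount_congr (hn : 3 ≤ n) {g g' : Sym2 (Fin n) → X}
    (h : triangleDist g' = triangleDist g) (x : X) : edgeCount g x = edgeCount g' x := by
  have e := sum_distinct_congr h fun y _ => if y = x then 1 else 0
  rw [sum_distinct_edge, sum_distinct_edge] at e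
  exact Nat.eq_of_mul_eq_mul_left (by omega) e

theorem nodeCount_congr (hn : 3 ≤ n) {g g' : Sym2 (Fin n) → X}
    (h : triangleDist g' = triangleDist g) (c : X) : nodeCount g c = nodeCount g' c := by
  have e := sum_distinct_congr h fun _ y => if y = c then 1 else 0
  rw [sum_distinct_node, sum_distinct_node] at e
  exact Nat.eq_of_mul_eq_mul_left (Nat.mul_pos (by omega) (by omega)) e

theorem incidenceCount_congr (hn : 3 ≤ n) {g g' : Sym2 (Fin n) → X}
    (h : triangleDist g' = triangleDist g) (x c : X) :
    incidenceCount g x c = incidenceCount g' x c := by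
  have e := sum_distinct_congr h fun y z => if y = x ∧ z = c then 1 else 0
  have h1 := sum_distinct_edge_node g x c
  have h2 := sum_distinct_edge_node g' x c
  rw [edgeCount_congr hn h, nodeCount_congr hn h, ← h2] at h1
  omega

theorem edgeCount_eq_card (g : Sym2 (Fin n) → X) (x : X) :
    edgeCount g x = #{p : Fin n × Fin n | p.1 ≠ p.2 ∧ g s(p.1, p.2) = x} := by
  rw [card_filter, Fintype.sum_prod_type]
  rfl

theorem eq_of_edgeCount_eq_two {g : Sym2 (Fin n) → X} {x : X} (hx : edgeCount g x = 2)
    {a b c d : Fin n} (hab : a ≠ b) (hcd : c ≠ d) (h1 : g s(a, b) = x) (h2 : g s(c, d) = x) :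
    s(c, d) = s(a, b) := by
  rw [edgeCount_eq_card] at hx
  have hsub : ({(a, b), (b, a)} : Finset (Fin n × Fin n)) ⊆
      ({p : Fin n × Fin n | p.1 ≠ p.2 ∧ g s(p.1, p.2) = x} : Finset _) := by
    intro p hp
    simp only [mem_insert, mem_singleton] at hp
    rcases hp with rfl | rfl
    · simp [hab, h1]
    · simp [hab.symm, Sym2.eq_swap (a := b), h1]
  have hcard : #({(a, b), (b, a)} : Finset (Fin n × Fin n)) = 2 :=
    card_pair (by simp [hab])
  have heq := eq_of_subset_of_card_le hsub (by rw [hx, hcard])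
  have hmem : (c, d) ∈ ({(a, b), (b, a)} : Finset (Fin n × Fin n)) := by
    rw [heq]; simp [hcd, h2]
  simpa using hmem

theorem edgeCount_eq_two_of_mem_uniqueEdges {g : Sym2 (Fin n) → X} {a b : Fin n}
    (h : s(a, b) ∈ uniqueEdges g) : edgeCount g (g s(a, b)) = 2 := by
  obtain ⟨hd, hu⟩ := h
  have hab : a ≠ b := by simpa using hd
  rw [edgeCount_eq_card]
  have : ({p : Fin n × Fin n | p.1 ≠ p.2 ∧ g s(p.1, p.2) = g s(a, b)} : Finset _) =
      {(a, b), (b, a)} := by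
    ext ⟨c, d⟩
    simp only [mem_filter, mem_univ, true_and, mem_insert, mem_singleton, Prod.mk.injEq]
    rw [← Sym2.eq_iff]
    constructor
    · rintro ⟨hcd, he⟩
      by_contra hne
      exact hu s(c, d) (by simpa using hcd) hne he
    · intro he
      refine ⟨?_, by rw [he]⟩
      rintro rfl
      exact hd (he ▸ Sym2.diag_isDiag c)
  rw [this]
  exact card_pair (by simp [hab])

/-- The weights of the uniquely weighted edges at the node `v`. -/
noncomputable def labels (g : Sym2 (Fin n) → X) (v : Fin n) : Finset X :=
  ({a : Fin n | v ≠ a ∧ edgeCount g (g s(v, a)) = 2} : Finset (Fin n)).image fun a => g s(v, a)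

theorem mem_labels {g : Sym2 (Fin n) → X} {v : Fin n} {x : X} :
    x ∈ labels g v ↔ edgeCount g x = 2 ∧ ∃ a, v ≠ a ∧ g s(v, a) = x := by
  simp only [labels, mem_image, mem_filter, mem_univ, true_and]
  constructor
  · rintro ⟨a, ⟨h1, h2⟩, rfl⟩
    exact ⟨h2, a, h1, rfl⟩
  · rintro ⟨h1, a, h2, rfl⟩
    exact ⟨a, ⟨h2, h1⟩, rfl⟩

theorem mem_of_mem_labels {g : Sym2 (Fin n) → X} {u a b : Fin n} (hab : a ≠ b)
    (h : g s(a, b) ∈ labels g u) : u ∈ s(a, b) := by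
  obtain ⟨hx, c, huc, hc⟩ := mem_labels.1 h
  rw [← eq_of_edgeCount_eq_two hx hab huc rfl hc]
  exact Sym2.mem_mk_left u c

theorem eq_of_mem_labels {g : Sym2 (Fin n) → X} {u v : Fin n} {x y : X} (hxy : x ≠ y)
    (hxu : x ∈ labels g u) (hyu : y ∈ labels g u) (hxv : x ∈ labels g v)
    (hyv : y ∈ labels g v) : u = v := by
  obtain ⟨-, a, hva, rfl⟩ := mem_labels.1 hxv
  obtain ⟨-, b, hvb, rfl⟩ := mem_labels.1 hyv
  have h1 := mem_of_mem_labels hva hxu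
  have h2 := mem_of_mem_labels hvb hyu
  rw [Sym2.mem_iff] at h1 h2
  rcases h1 with h1 | rfl
  · exact h1
  rcases h2 with h2 | rfl
  · exact h2
  exact absurd rfl hxy

theorem exists_of_subset_labels (hn : 3 ≤ n) {g g' : Sym2 (Fin n) → X}
    (h : triangleDist g' = triangleDist g) {B : Finset X} {x y : X} (hx : x ∈ B) (hy : y ∈ B)
    (hxy : x ≠ y) {v : Fin n} (hB : B ⊆ labels g v) :
    ∃ v', B ⊆ labels g' v' ∧ g' s(v', v') = g s(v, v) := by
  obtain ⟨hx2, a, hva, rfl⟩ := mem_labels.1 (hB hx)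
  obtain ⟨hy2, b, hvb, rfl⟩ := mem_labels.1 (hB hy)
  have hab : a ≠ b := by rintro rfl; exact hxy rfl
  obtain ⟨v', a', b', hva', hvb', hab', e1, e2, e3, e4, e5, e6⟩ :=
    exists_matching_triangle h hva hvb hab
  refine ⟨v', fun z hz => ?_, e4.symm⟩
  obtain ⟨hz2, c, hvc, rfl⟩ := mem_labels.1 (hB hz)
  rw [edgeCount_congr hn h] at hz2
  have meet : ∀ d d', v ≠ d → v' ≠ d' → g s(v, d) = g' s(v', d') →
      edgeCount g' (g s(v, d)) = 2 →
      g s(v, c) ∈ labels g' v' ∨ g s(v, c) ∈ labels g' d' := by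
    intro d d' hvd hvd' e hd2
    by_cases hdc : d = c
    · subst hdc
      exact Or.inl (mem_labels.2 ⟨hz2, d', hvd', e.symm⟩)
    obtain ⟨p, q, r, hpq, hpr, hqr, f1, f2, f3, f4, f5, f6⟩ :=
      exists_matching_triangle h hvd hvc hdc
    have hs := eq_of_edgeCount_eq_two hd2 hpq hvd' f1.symm e.symm
    have hp : p = v' ∨ p = d' := by
      have : p ∈ s(v', d') := by rw [hs]; exact Sym2.mem_mk_left p q
      simpa using this
    rcases hp with rfl | rfl
    · exact Or.inl (mem_labels.2 ⟨hz2, r, hpr, f2.symm⟩)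
    · exact Or.inr (mem_labels.2 ⟨hz2, r, hpr, f2.symm⟩)
  rw [edgeCount_congr hn h] at hx2 hy2
  rcases meet a a' hva hva' e1 hx2 with h1 | h1
  · exact h1
  rcases meet b b' hvb hvb' e2 hy2 with h2 | h2
  · exact h2
  exfalso
  obtain ⟨-, d, had, hd⟩ := mem_labels.1 h1
  rw [← hd] at h2
  have h3 := mem_of_mem_labels had h2
  rw [Sym2.mem_iff] at h3
  rcases h3 with h3 | rfl
  · exact hab' h3.symm
  rw [← e3] at hd
  have h5 := mem_of_mem_labels hab (hd ▸ hB hz)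
  rw [Sym2.mem_iff] at h5
  rcases h5 with h5 | h5
  · exact hva h5
  · exact hvb h5

theorem card_subset_labels_le (hn : 3 ≤ n) {g g' : Sym2 (Fin n) → X}
    (h : triangleDist g' = triangleDist g) (B : Finset X) (c : X) :
    #{v | B ⊆ labels g v ∧ g s(v, v) = c} ≤ #{v | B ⊆ labels g' v ∧ g' s(v, v) = c} := by
  rcases lt_or_ge 1 #B with hB | hB
  · obtain ⟨x, hx, y, hy, hxy⟩ := one_lt_card.1 hB
    rcases eq_empty_or_nonempty ({v | B ⊆ labels g v ∧ g s(v, v) = c} : Finset (Fin n))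
      with he | ⟨v, hv⟩
    · rw [he]; simp
    refine (card_le_one.2 fun u hu v hv => ?_).trans (card_pos.2 ?_)
    · simp only [mem_filter, mem_univ, true_and] at hu hv
      exact eq_of_mem_labels hxy (hu.1 hx) (hu.1 hy) (hv.1 hx) (hv.1 hy)
    · simp only [mem_filter, mem_univ, true_and] at hv
      obtain ⟨v', h1, h2⟩ := exists_of_subset_labels hn h hx hy hxy hv.1
      exact ⟨v', by simp [h1, h2, hv.2]⟩
  rcases eq_empty_or_nonempty B with rfl | hne
  · have := nodeCount_congr hn h c
    simp only [nodeCount, ← card_filter] at this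
    simp [this]
  obtain ⟨x, rfl⟩ := card_eq_one.1 (le_antisymm hB (card_pos.2 hne))
  simp only [singleton_subset_iff]
  by_cases hx : edgeCount g x = 2
  · have key : ∀ g : Sym2 (Fin n) → X, edgeCount g x = 2 →
        #{v | x ∈ labels g v ∧ g s(v, v) = c} = incidenceCount g x c := by
      intro g hx
      rw [incidenceCount, card_filter]
      refine sum_congr rfl fun v _ => ?_
      rw [← card_filter]
      split_ifs with hv
      · obtain ⟨⟨-, a, hva, ha⟩, hc⟩ := hv.imp_left mem_labels.1
        refine (card_eq_one.2 ⟨a, ?_⟩).symm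
        ext b
        simp only [mem_filter, mem_univ, true_and, mem_singleton]
        constructor
        · rintro ⟨hvb, hb, -⟩
          exact Sym2.congr_right.1 (eq_of_edgeCount_eq_two hx hva hvb ha hb)
        · rintro rfl
          exact ⟨hva, ha, hc⟩
      · symm
        rw [card_eq_zero, filter_eq_empty_iff]
        rintro a - ⟨hva, ha, hc⟩
        exact hv ⟨mem_labels.2 ⟨hx, a, hva, ha⟩, hc⟩
    rw [key g hx, key g' (edgeCount_congr hn h x ▸ hx), incidenceCount_congr hn h]
  · rw [filter_false_of_mem (fun v _ hv => hx (mem_labels.1 hv.1).1)]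
    simp

/-- Functions into finsets whose upper sets have the same sizes have fibers of the same sizes. -/
theorem card_fiber_eq_of_card_subset_eq {V Y : Type*} [Fintype V] (L L' : V → Finset Y)
    (P P' : V → Prop) (hLL : ∀ B, #{v | B ⊆ L v ∧ P v} = #{v | B ⊆ L' v ∧ P' v})
    (A : Finset Y) : #{v | L v = A ∧ P v} = #{v | L' v = A ∧ P' v} := by
  set S : Finset (Finset Y) := univ.image L ∪ univ.image L' with hS
  have hA : ∀ B, B ∈ S → #B ≤ S.sup card := fun B hB => le_sup (f := card) hB
  induction hm : S.sup card + 1 - #A using Nat.strong_induction_on generalizing A with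
  | _ m ih =>
  subst hm
  have split : ∀ (K : V → Finset Y) (Q : V → Prop), (∀ v, K v ∈ S) →
      #{v | A ⊆ K v ∧ Q v} =
        #{v | K v = A ∧ Q v} + ∑ B ∈ S with A ⊂ B, #{v | K v = B ∧ Q v} := by
    intro K Q hK
    have h1 : ({v | A ⊆ K v ∧ Q v} : Finset V) =
        ({v | K v = A ∧ Q v} : Finset V) ∪ ({v | A ⊂ K v ∧ Q v} : Finset V) := by
      ext v
      simp only [mem_filter, mem_univ, true_and, mem_union, subset_iff_ssubset_or_eq,
        eq_comm (a := A)]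
      tauto
    rw [h1, card_union_of_disjoint, card_eq_sum_card_fiberwise (f := K)
      (s := ({v | A ⊂ K v ∧ Q v} : Finset V)) (t := S.filter (A ⊂ ·))]
    · congr 1
      refine sum_congr rfl fun B hB => ?_
      congr 1
      ext v
      simp only [mem_filter, mem_univ, true_and] at hB ⊢
      constructor
      · rintro ⟨⟨-, h2⟩, h3⟩
        exact ⟨h3, h2⟩
      · rintro ⟨rfl, h3⟩
        exact ⟨⟨hB.2, h3⟩, rfl⟩
    · intro v hv
      simp only [coe_filter, mem_univ, true_and, Set.mem_ofPred_eq] at hv ⊢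
      exact ⟨hK v, hv.1⟩
    · rw [disjoint_filter]
      rintro v - ⟨rfl, -⟩ ⟨h, -⟩
      exact (ssubset_irrefl _ h)
  have s1 := split L P fun v => mem_union_left _ (mem_image_of_mem _ (mem_univ v))
  have s2 := split L' P' fun v => mem_union_right _ (mem_image_of_mem _ (mem_univ v))
  have s3 : ∑ B ∈ S with A ⊂ B, #{v | L v = B ∧ P v} =
      ∑ B ∈ S with A ⊂ B, #{v | L' v = B ∧ P' v} := by
    refine sum_congr rfl fun B hB => ?_
    rw [mem_filter] at hB
    refine ih _ ?_ B rfl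
    have := card_lt_card hB.2
    have := hA B hB.1
    omega
  have := hLL A
  omega

theorem exists_perm_labels (hn : 3 ≤ n) {g g' : Sym2 (Fin n) → X}
    (h : triangleDist g' = triangleDist g) :
    ∃ π : Equiv.Perm (Fin n), ∀ i,
      labels g i = labels g' (π i) ∧ g s(i, i) = g' s(π i, π i) := by
  have hfib : ∀ t : Finset X × X, Nonempty
      ({i // (labels g i, g s(i, i)) = t} ≃ {i // (labels g' i, g' s(i, i)) = t}) := by
    rintro ⟨A, c⟩
    refine ⟨Fintype.equivOfCardEq ?_⟩
    simpa only [Fintype.card_subtype, Prod.mk.injEq] using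
      card_fiber_eq_of_card_subset_eq (labels g) (labels g') (fun v => g s(v, v) = c)
        (fun v => g' s(v, v) = c) (fun B => le_antisymm (card_subset_labels_le hn h B c)
          (card_subset_labels_le hn h.symm B c)) A
  let π : Equiv.Perm (Fin n) := Equiv.ofFiberEquiv (f := fun i => (labels g i, g s(i, i)))
    (g := fun i => (labels g' i, g' s(i, i))) fun t => (hfib t).some
  refine ⟨π, fun i => ?_⟩
  have hπ := Equiv.ofFiberEquiv_map (f := fun i => (labels g i, g s(i, i)))
    (g := fun i => (labels g' i, g' s(i, i))) (fun t => (hfib t).some) i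
  exact ⟨(congrArg Prod.fst hπ).symm, (congrArg Prod.snd hπ).symm⟩

end PartialIsomorphism

/-- Partial isomorphism lemma: if `T_{G'} = T_G`, then there is a permutation
`π` of the nodes matching all node weights, all edge weights of edges in `E`,
and all edge weights of edges whose two endpoints are joined to a common node
by edges in `E`. -/
theorem partial_isomorphism {n : ℕ} {X : Type*} (hn : 3 ≤ n)
    (g g' : Sym2 (Fin n) → X) (h : triangleDist g' = triangleDist g) :
    ∃ π : Equiv.Perm (Fin n),
      (∀ i : Fin n, g s(i, i) = g' s(π i, π i)) ∧
      (∀ i j : Fin n, i ≠ j → s(i, j) ∈ uniqueEdges g →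
        g s(i, j) = g' s(π i, π j)) ∧
      (∀ i j k : Fin n, i ≠ j → j ≠ k → i ≠ k →
        s(i, k) ∈ uniqueEdges g → s(j, k) ∈ uniqueEdges g →
        g s(i, j) = g' s(π i, π j)) := by
  obtain ⟨π, hπ⟩ := exists_perm_labels hn h
  have edge : ∀ i j : Fin n, i ≠ j → s(i, j) ∈ uniqueEdges g →
      g s(i, j) = g' s(π i, π j) := by
    intro i j hij hE
    have h2 := edgeCount_eq_two_of_mem_uniqueEdges hE
    have hi : g s(i, j) ∈ labels g' (π i) :=
      (hπ i).1 ▸ mem_labels.2 ⟨h2, j, hij, rfl⟩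
    have hj : g s(i, j) ∈ labels g' (π j) :=
      (hπ j).1 ▸ mem_labels.2 ⟨h2, i, hij.symm, by rw [Sym2.eq_swap]⟩
    obtain ⟨-, a, hia, ha⟩ := mem_labels.1 hi
    rw [← ha] at hj
    have hm := mem_of_mem_labels hia hj
    rw [Sym2.mem_iff] at hm
    rcases hm with hm | hm
    · exact absurd (π.injective hm).symm hij
    · rw [hm, ha]
  refine ⟨π, fun i => (hπ i).2, edge, ?_⟩
  intro i j k hij hjk hik hE hF
  obtain ⟨p, q, r, hpq, hpr, hqr, e1, e2, e3, -⟩ := exists_matching_triangle h hij hik hjk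
  have h1 := edgeCount_eq_two_of_mem_uniqueEdges hE
  have h2 := edgeCount_eq_two_of_mem_uniqueEdges hF
  rw [edgeCount_congr hn h] at h1 h2
  have hpr' := eq_of_edgeCount_eq_two h1 (π.injective.ne hik) hpr (edge i k hik hE).symm e2.symm
  have hqr' := eq_of_edgeCount_eq_two h2 (π.injective.ne hjk) hqr (edge j k hjk hF).symm e3.symm
  have hij' := π.injective.ne hij
  rw [e1]
  rw [Sym2.eq_iff] at hpr' hqr'
  grind
end

section
/- Let n ≥ 5 and let φ be a permutation of the set of 2-element subsets { {i,j} : i, j ∈ {1,…,n}, i ≠ j }. Then there exists a permutation π of {1,…,n} such that φ({i,j}) = {π(i), π(j)} for every i ≠ j if and only if φ({i,j}) ∩ φ({j,k}) ≠ ∅ for every triple of pairwise distinct i, j, k ∈ {1,…,n}. -/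
/-- The 2-element subsets of `{1,…,n}`, viewed as non-diagonal elements of
`Sym2 (Fin n)`. -/
abbrev NDPair (n : ℕ) := {p : Sym2 (Fin n) // ¬ p.IsDiag}

/-- The 2-element subset `{i,j}` for `i ≠ j`. -/
def ndPair {n : ℕ} (i j : Fin n) (h : i ≠ j) : NDPair n :=
  ⟨s(i, j), by simpa [Sym2.mk_isDiag_iff] using h⟩

theorem Sym2.eq_mk_of_mem_of_ne {α : Type*} {e : Sym2 α} {x y : α} (hx : x ∈ e) (hy : y ∈ e)
    (h : x ≠ y) : e = s(x, y) :=
  (Sym2.mem_and_mem_iff h).1 ⟨hx, hy⟩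

/-- At least four pairwise intersecting distinct edges have a common vertex. -/
theorem Sym2.exists_forall_mem_of_pairwise_inter {ι α : Type*} [Fintype ι]
    (hι : 4 ≤ Fintype.card ι) (e : ι → Sym2 α) (he : Function.Injective e)
    (hd : ∀ i, ¬ (e i).IsDiag) (hi : ∀ i j, i ≠ j → ∃ x, x ∈ e i ∧ x ∈ e j) :
    ∃ w, ∀ i, w ∈ e i := by
  classical
  obtain ⟨a, b, hab⟩ := Fintype.exists_pair_of_one_lt_card (α := ι) (by omega)
  obtain ⟨w, hwa, hwb⟩ := hi a b hab
  by_contra! hcon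
  obtain ⟨c, hc⟩ := hcon w
  have hca : c ≠ a := by rintro rfl; exact hc hwa
  have hcb : c ≠ b := by rintro rfl; exact hc hwb
  obtain ⟨d, hdmem⟩ : ∃ d, d ∉ ({a, b, c} : Finset ι) := by
    by_contra! hall
    have h₁ := Finset.card_le_three (a := a) (b := b) (c := c)
    rw [Finset.eq_univ_iff_forall.2 hall, Finset.card_univ] at h₁
    omega
  simp only [Finset.mem_insert, Finset.mem_singleton, not_or] at hdmem
  obtain ⟨hda, hdb, hdc⟩ := hdmem
  obtain ⟨p, hp⟩ := hwa
  obtain ⟨q, hq⟩ := hwb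
  have hwp : w ≠ p := by simpa [hp] using hd a
  have hwq : w ≠ q := by simpa [hq] using hd b
  have hpq : p ≠ q := by
    rintro rfl
    exact hab (he (hp.trans hq.symm))
  have hpc : p ∈ e c := by
    obtain ⟨x, hx, hxa⟩ := hi c a hca
    rw [hp, Sym2.mem_iff] at hxa
    rcases hxa with rfl | rfl
    exacts [absurd hx hc, hx]
  have hqc : q ∈ e c := by
    obtain ⟨x, hx, hxb⟩ := hi c b hcb
    rw [hq, Sym2.mem_iff] at hxb
    rcases hxb with rfl | rfl
    exacts [absurd hx hc, hx]
  have hpqc := Sym2.eq_mk_of_mem_of_ne hpc hqc hpq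
  have nwp : ¬ (w ∈ e d ∧ p ∈ e d) := fun h =>
    hda (he ((Sym2.eq_mk_of_mem_of_ne h.1 h.2 hwp).trans hp.symm))
  have nwq : ¬ (w ∈ e d ∧ q ∈ e d) := fun h =>
    hdb (he ((Sym2.eq_mk_of_mem_of_ne h.1 h.2 hwq).trans hq.symm))
  have npq : ¬ (p ∈ e d ∧ q ∈ e d) := fun h =>
    hdc (he ((Sym2.eq_mk_of_mem_of_ne h.1 h.2 hpq).trans hpqc.symm))
  have mwp : w ∈ e d ∨ p ∈ e d := by
    obtain ⟨x, hx, hxa⟩ := hi d a hda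
    rw [hp, Sym2.mem_iff] at hxa
    rcases hxa with rfl | rfl <;> simp [hx]
  have mwq : w ∈ e d ∨ q ∈ e d := by
    obtain ⟨x, hx, hxb⟩ := hi d b hdb
    rw [hq, Sym2.mem_iff] at hxb
    rcases hxb with rfl | rfl <;> simp [hx]
  have mpq : p ∈ e d ∨ q ∈ e d := by
    obtain ⟨x, hx, hxc⟩ := hi d c hdc
    rw [hpqc, Sym2.mem_iff] at hxc
    rcases hxc with rfl | rfl <;> simp [hx]
  tauto

theorem ndPair_comm {n : ℕ} (i j : Fin n) (h : i ≠ j) : ndPair i j h = ndPair j i h.symm :=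
  Subtype.ext Sym2.eq_swap


/-- Let `n ≥ 5` and let `φ` be a permutation of the set of 2-element subsets of
`{1,…,n}`.  Then `φ` is induced by a permutation `π` of `{1,…,n}` (i.e.
`φ({i,j}) = {π i, π j}` for all `i ≠ j`) if and only if `φ({i,j})` and
`φ({j,k})` intersect for all pairwise distinct `i, j, k`. -/
theorem perm_of_pairs_induced_iff {n : ℕ} (hn : 5 ≤ n)
    (φ : Equiv.Perm (NDPair n)) :
    (∃ π : Equiv.Perm (Fin n), ∀ (i j : Fin n) (h : i ≠ j),
        ((φ (ndPair i j h)) : Sym2 (Fin n)) = s(π i, π j)) ↔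
    (∀ (i j k : Fin n) (hij : i ≠ j) (hjk : j ≠ k) (_hik : i ≠ k),
        ∃ x : Fin n, x ∈ ((φ (ndPair i j hij)) : Sym2 (Fin n)) ∧
          x ∈ ((φ (ndPair j k hjk)) : Sym2 (Fin n))) := by
  constructor
  · rintro ⟨π, hπ⟩ i j k hij hjk -
    exact ⟨π j, by simp [hπ], by simp [hπ]⟩
  intro H
  have star : ∀ i : Fin n, ∃ w : Fin n, ∀ j (h : i ≠ j), w ∈ (φ (ndPair i j h)).1 := by
    intro i
    obtain ⟨w, hw⟩ := Sym2.exists_forall_mem_of_pairwise_inter (ι := {j : Fin n // i ≠ j})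
      (by
        have := Fintype.card_subtype_compl (fun j : Fin n => i = j)
        simp only [Fintype.card_fin, Fintype.card_subtype_eq'] at this
        simp only [ne_eq]
        omega)
      (fun j => (φ (ndPair i j.1 j.2)).1)
      (by
        rintro ⟨j, hj⟩ ⟨k, hk⟩ h
        have h' := congrArg Subtype.val (φ.injective (Subtype.ext h))
        exact Subtype.ext (Sym2.congr_right.1 h'))
      (fun j => (φ (ndPair i j.1 j.2)).2)
      (by
        rintro ⟨j, hj⟩ ⟨k, hk⟩ h
        have := H j i k hj.symm hk (fun e => h (Subtype.ext e))
        rwa [ndPair_comm j i] at this)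
    exact ⟨w, fun j h => hw ⟨j, h⟩⟩
  choose σ hσ using star
  have hσ' : ∀ i j (h : i ≠ j), σ j ∈ (φ (ndPair i j h)).1 := fun i j h => by
    rw [ndPair_comm]; exact hσ j i h.symm
  have inj : Function.Injective σ := by
    intro i j hij
    by_contra hne
    have const : ∀ k, σ k = σ i := by
      intro k
      by_cases hki : i = k
      · rw [hki]
      by_cases hkj : j = k
      · rw [← hkj, hij]
      by_contra hk
      have h₁ := Sym2.eq_mk_of_mem_of_ne (hσ' i k hki) (hσ i k hki) hk
      have h₂ := Sym2.eq_mk_of_mem_of_ne (hσ' j k hkj) (hij ▸ hσ j k hkj) hk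
      have h₃ := congrArg Subtype.val (φ.injective (Subtype.ext (h₁.trans h₂.symm)))
      exact hne (Sym2.congr_left.1 h₃)
    obtain ⟨x, y, hx, hy, hxy⟩ : ∃ x y : Fin n, x ≠ σ i ∧ y ≠ σ i ∧ x ≠ y := by
      have : 1 < ((Finset.univ : Finset (Fin n)).erase (σ i)).card := by
        rw [Finset.card_erase_of_mem (Finset.mem_univ _), Finset.card_univ, Fintype.card_fin]
        omega
      obtain ⟨x, hx, y, hy, hxy⟩ := Finset.one_lt_card.1 this
      exact ⟨x, y, Finset.ne_of_mem_erase hx, Finset.ne_of_mem_erase hy, hxy⟩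
    obtain ⟨⟨p, hp⟩, hpe⟩ := φ.surjective (ndPair x y hxy)
    induction p with | _ a b
    have hab : a ≠ b := by simpa using hp
    have hm := hσ a b hab
    rw [const, show ndPair a b hab = ⟨s(a, b), hp⟩ from rfl, hpe] at hm
    rcases Sym2.mem_iff.1 hm with h | h
    exacts [hx h.symm, hy h.symm]
  refine ⟨Equiv.ofBijective σ (Finite.injective_iff_bijective.1 inj), fun i j h => ?_⟩
  exact Sym2.eq_mk_of_mem_of_ne (hσ i j h) (hσ' i j h) (inj.ne h)
end

section
/- Let G be a graph with n ≥ 5 nodes and real edge weights g_{i,j} ∈ ℝ (and no node weights). Suppose that g_{i,j} + g_{j,k} ≠ g_{m,p} + g_{q,r} for every pairwise distinct i, j, k ∈ {1,…,n} and every pairwise distinct m, p, q, r ∈ {1,…,n}. Then G is reconstructible from D_g(G) and D_α(G): every graph G' with n nodes and real edge weights such that D_g(G') = D_g(G) and D_α(G') = D_α(G) is isomorphic to G. -/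
/-- The multiset of sums of adjacent edge weights
`α_{i,j,k} = g{i,j} + g{j,k}` over triples of pairwise distinct `i, j, k`. -/
def adjDist {n : ℕ} {X : Type*} [Add X] (g : Sym2 (Fin n) → X) : Multiset X :=
  ((Finset.univ : Finset (Fin n × Fin n × Fin n)).filter
      (fun p => p.1 ≠ p.2.1 ∧ p.2.1 ≠ p.2.2 ∧ p.1 ≠ p.2.2)).val.map
    (fun p => g s(p.1, p.2.1) + g s(p.2.1, p.2.2))

/-- Two graphs with edge weights and no node weights are isomorphic if there is
a permutation `π` of the nodes with `g'{i,j} = g{π i, π j}` for all `i ≠ j`. -/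
def EdgeGraphIso {n : ℕ} {X : Type*} (g g' : Sym2 (Fin n) → X) : Prop :=
  ∃ π : Equiv.Perm (Fin n), ∀ i j : Fin n, i ≠ j → g' s(i, j) = g s(π i, π j)

/-- A family of at least four pairwise intersecting edges has a common vertex. -/
lemma exists_common_mem_of_pairwise_inter {α : Type*} [DecidableEq α] (S : Finset (Sym2 α))
    (hcard : 4 ≤ S.card) (hdiag : ∀ e ∈ S, ¬ e.IsDiag)
    (hinter : ∀ e ∈ S, ∀ f ∈ S, e ≠ f → ∃ v, v ∈ e ∧ v ∈ f) :
    ∃ c, ∀ e ∈ S, c ∈ e := by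
  obtain ⟨e₁, h₁, e₂, h₂, h₁₂⟩ := Finset.one_lt_card.mp (by lia : 1 < S.card)
  obtain ⟨c, hc₁, hc₂⟩ := hinter e₁ h₁ e₂ h₂ h₁₂
  obtain ⟨a, rfl⟩ := hc₁
  obtain ⟨b, rfl⟩ := hc₂
  by_contra! hcon
  obtain ⟨e₃, h₃, hc₃⟩ := hcon c
  have hmem₃ : a ∈ e₃ ∧ b ∈ e₃ := by
    have h₁₃ := hinter _ h₁ _ h₃ (by rintro rfl; simp at hc₃)
    have h₂₃ := hinter _ h₂ _ h₃ (by rintro rfl; simp at hc₃)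
    simp only [Sym2.mem_iff] at h₁₃ h₂₃
    grind
  have hab : a ≠ b := by rintro rfl; exact h₁₂ rfl
  obtain rfl : e₃ = s(a, b) := (Sym2.mem_and_mem_iff hab).mp hmem₃
  obtain ⟨e₄, h₄, h₄'⟩ := Finset.exists_mem_notMem_of_card_lt_card
    (s := {s(c, a), s(c, b), s(a, b)}) (t := S) (Finset.card_le_three.trans_lt (by lia))
  simp only [Finset.mem_insert, Finset.mem_singleton, not_or] at h₄'
  obtain ⟨n₁, n₂, n₃⟩ := h₄'
  have i₁ := hinter _ h₁ _ h₄ (Ne.symm n₁)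
  have i₂ := hinter _ h₂ _ h₄ (Ne.symm n₂)
  have i₃ := hinter _ h₃ _ h₄ (Ne.symm n₃)
  have hca : c ≠ a := hdiag _ h₁
  have hcb : c ≠ b := hdiag _ h₂
  have k₁ := mt (Sym2.mem_and_mem_iff hca).mp n₁
  have k₂ := mt (Sym2.mem_and_mem_iff hcb).mp n₂
  have k₃ := mt (Sym2.mem_and_mem_iff hab).mp n₃
  simp only [Sym2.mem_iff] at i₁ i₂ i₃
  grind

/-- Whitney's theorem for complete graphs: an injection of the edges of the complete graph on
`n ≥ 5` nodes that preserves adjacency is induced by a permutation of the nodes. -/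
lemma exists_perm_of_preserves_adjacency {n : ℕ} (hn : 5 ≤ n)
    (φ : Sym2 (Fin n) → Sym2 (Fin n))
    (hdiag : ∀ e, ¬ e.IsDiag → ¬ (φ e).IsDiag)
    (hinj : ∀ e f, ¬ e.IsDiag → ¬ f.IsDiag → φ e = φ f → e = f)
    (hadj : ∀ i j k, i ≠ j → j ≠ k → i ≠ k → ∃ v, v ∈ φ s(i, j) ∧ v ∈ φ s(j, k)) :
    ∃ π : Equiv.Perm (Fin n), ∀ i j, i ≠ j → φ s(i, j) = s(π i, π j) := by
  have star_card (v : Fin n) : ((Finset.univ.erase v).image fun l => s(v, l)).card = n - 1 := by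
    rw [Finset.card_image_of_injective _ (fun a b h => Sym2.congr_right.mp h)]
    simp
  have center (v : Fin n) : ∃ c, ∀ l, v ≠ l → c ∈ φ s(v, l) := by
    obtain ⟨c, hc⟩ := exists_common_mem_of_pairwise_inter
      (((Finset.univ.erase v).image fun l => s(v, l)).image φ) (by
        rw [Finset.card_image_of_injOn, star_card]
        · lia
        · intro e he f hf
          simp only [Finset.coe_image, Set.mem_image, Finset.mem_coe, Finset.mem_erase] at he hf
          obtain ⟨a, ha, rfl⟩ := he
          obtain ⟨b, hb, rfl⟩ := hf
          exact hinj _ _ (by simpa using ha.1.symm) (by simpa using hb.1.symm))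
      (by
        simp only [Finset.mem_image, Finset.mem_erase]
        rintro _ ⟨_, ⟨a, ha, rfl⟩, rfl⟩
        exact hdiag _ (by simpa using ha.1.symm))
      (by
        simp only [Finset.mem_image, Finset.mem_erase]
        rintro _ ⟨_, ⟨a, ha, rfl⟩, rfl⟩ _ ⟨_, ⟨b, hb, rfl⟩, rfl⟩ hne
        rw [Sym2.eq_swap (a := v) (b := a)]
        exact hadj a v b ha.1 hb.1.symm (by rintro rfl; exact hne rfl))
    refine ⟨c, fun l hl => hc _ (Finset.mem_image_of_mem _ (Finset.mem_image_of_mem _ ?_))⟩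
    simpa using hl.symm
  choose π hπ using center
  have π_inj : Function.Injective π := by
    intro i j hij
    by_contra hne
    obtain ⟨k, hk⟩ : ∃ k, k ∉ ({i, j} : Finset (Fin n)) := by
      by_contra! h
      have h₁ := Finset.card_le_card (fun x _ => h x : Finset.univ ⊆ ({i, j} : Finset (Fin n)))
      have h₂ := Finset.card_le_two (a := i) (b := j)
      simp at h₁
      lia
    simp only [Finset.mem_insert, Finset.mem_singleton, not_or] at hk
    set T := insert s(j, k) ((Finset.univ.erase i).image fun l => s(i, l)) with hT
    have T_card : T.card = n - 1 + 1 := by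
      rw [hT, Finset.card_insert_of_notMem, star_card]
      simp only [Finset.mem_image, not_exists]
      rintro x ⟨-, hx⟩
      have : i ∈ s(j, k) := hx ▸ Sym2.mem_mk_left i x
      rw [Sym2.mem_iff] at this
      grind
    have T_spec : ∀ e ∈ T, ¬ e.IsDiag ∧ π i ∈ φ e := by
      simp only [hT, Finset.mem_insert, Finset.mem_image, Finset.mem_erase]
      rintro e (rfl | ⟨l, hl, rfl⟩)
      · exact ⟨by simpa using Ne.symm hk.2, hij ▸ hπ j k (Ne.symm hk.2)⟩
      · exact ⟨by simpa using hl.1.symm, hπ i l hl.1.symm⟩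
    have hle := Finset.card_le_card_of_injOn φ
      (s := T) (t := (Finset.univ.erase (π i)).image fun l => s(π i, l))
      (by
        intro e he
        obtain ⟨h₁, h₂⟩ := T_spec e he
        have h₃ := hdiag e h₁
        obtain ⟨y, hy⟩ := h₂
        rw [hy] at h₃
        simp only [Finset.coe_image, Set.mem_image, Finset.mem_coe, Finset.mem_erase]
        exact ⟨y, ⟨fun h => h₃ (by simp [h]), Finset.mem_univ _⟩, hy.symm⟩)
      (fun e he f hf => hinj e f (T_spec e he).1 (T_spec f hf).1)
    rw [T_card, star_card] at hle
    lia
  refine ⟨Equiv.ofBijective π (Finite.injective_iff_bijective.mp π_inj), fun i j hij => ?_⟩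
  refine (Sym2.mem_and_mem_iff (π_inj.ne hij)).mp ⟨hπ i j hij, ?_⟩
  rw [Sym2.eq_swap]
  exact hπ j i hij.symm

/-- Two functions on a finite type with the same multiset of values differ by a permutation. -/
lemma exists_perm_of_map_univ_eq {α X : Type*} [Fintype α] {f f' : α → X}
    (h : (Finset.univ : Finset α).val.map f' = Finset.univ.val.map f) :
    ∃ σ : Equiv.Perm α, ∀ a, f (σ a) = f' a := by
  classical
  have fiber (x : X) : Nonempty ({a // f' a = x} ≃ {a // f a = x}) := by
    refine ⟨Fintype.equivOfCardEq ?_⟩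
    have hx := congrArg (Multiset.count x) h
    simp only [Multiset.count_map, ← Finset.filter_val, Finset.card_val] at hx
    simpa only [Fintype.card_subtype, eq_comm] using hx
  exact ⟨Equiv.ofFiberEquiv fun x => (fiber x).some, Equiv.ofFiberEquiv_map _⟩

/-- Equal edge distributions are related by an injection of the edges. -/
lemma exists_edge_map_of_edgeDist_eq {n : ℕ} {X : Type*} {g g' : Sym2 (Fin n) → X}
    (h : edgeDist g' = edgeDist g) :
    ∃ φ : Sym2 (Fin n) → Sym2 (Fin n), (∀ e, ¬ e.IsDiag → ¬ (φ e).IsDiag) ∧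
      (∀ e f, ¬ e.IsDiag → ¬ f.IsDiag → φ e = φ f → e = f) ∧
      ∀ e, ¬ e.IsDiag → g' e = g (φ e) := by
  let P := {p : Fin n × Fin n // p.1 < p.2}
  have key (f : Sym2 (Fin n) → X) : edgeDist f =
      (Finset.univ : Finset P).val.map fun p => f s(p.1.1, p.1.2) := by
    have : (Finset.univ : Finset (Fin n × Fin n)).filter (fun p => p.1 < p.2) =
        (Finset.univ : Finset P).map (Function.Embedding.subtype _) := by
      ext p
      simp [P]
    rw [edgeDist, this, Finset.map_val, Multiset.map_map]
    rfl
  rw [key, key] at h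
  obtain ⟨σ, hσ⟩ := exists_perm_of_map_univ_eq h
  have rep (e : Sym2 (Fin n)) (he : ¬ e.IsDiag) : ∃ p : P, s(p.1.1, p.1.2) = e := by
    induction e with | _ i j
    rcases lt_or_gt_of_ne (show i ≠ j by simpa using he) with hij | hij
    · exact ⟨⟨(i, j), hij⟩, rfl⟩
    · exact ⟨⟨(j, i), hij⟩, Sym2.eq_swap⟩
  choose p hp using rep
  have mk_inj (x y : P) (hxy : s(x.1.1, x.1.2) = s(y.1.1, y.1.2)) : x = y := by
    obtain ⟨⟨a, b⟩, hab⟩ := x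
    obtain ⟨⟨c, d⟩, hcd⟩ := y
    simp only [Sym2.eq_iff] at hxy hab hcd
    rcases hxy with ⟨rfl, rfl⟩ | ⟨rfl, rfl⟩
    · rfl
    · exact absurd hab hcd.asymm
  classical
  refine ⟨fun e => if he : e.IsDiag then e else
    s((σ (p e he)).1.1, (σ (p e he)).1.2), fun e he => ?_, fun e f he hf hef => ?_,
    fun e he => ?_⟩
  · simpa [he] using (σ (p e he)).2.ne
  · simp only [he, hf, dite_false] at hef
    have := σ.injective (mk_inj _ _ hef)
    rw [← hp e he, ← hp f hf, this]
  · simp only [he, dite_false]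
    rw [hσ, hp]

/-- A graph with `n ≥ 5` nodes and real edge weights such that no sum of
weights of two adjacent edges equals a sum of weights of two non-adjacent
edges is reconstructible from the distribution of its edge weights together
with the distribution of sums of adjacent edge weights. -/
theorem reconstructible_of_edgeDist_adjDist {n : ℕ} (hn : 5 ≤ n)
    (g : Sym2 (Fin n) → ℝ)
    (hyp : ∀ i j k m p q r : Fin n,
      i ≠ j → j ≠ k → i ≠ k →
      m ≠ p → m ≠ q → m ≠ r → p ≠ q → p ≠ r → q ≠ r →
      g s(i, j) + g s(j, k) ≠ g s(m, p) + g s(q, r)) :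
    ∀ g' : Sym2 (Fin n) → ℝ, edgeDist g' = edgeDist g →
      adjDist g' = adjDist g → EdgeGraphIso g g' := by
  intro g' hedge hadj
  obtain ⟨φ, hdiag, hinj, hφ⟩ := exists_edge_map_of_edgeDist_eq hedge
  obtain ⟨π, hπ⟩ := exists_perm_of_preserves_adjacency hn φ hdiag hinj fun i j k hij hjk hik => by
    have hmem : g' s(i, j) + g' s(j, k) ∈ adjDist g := by
      rw [← hadj]
      exact Multiset.mem_map.mpr ⟨(i, j, k), by simp [hij, hjk, hik], rfl⟩
    obtain ⟨⟨a, b, c⟩, habc, hsum⟩ := Multiset.mem_map.mp hmem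
    simp only [Finset.mem_val, Finset.mem_filter, Finset.mem_univ, true_and] at habc
    have h₁ := hdiag s(i, j) (by simpa using hij)
    have h₂ := hdiag s(j, k) (by simpa using hjk)
    rw [hφ s(i, j) (by simpa using hij), hφ s(j, k) (by simpa using hjk)] at hsum
    generalize φ s(i, j) = e at *
    generalize φ s(j, k) = f at *
    induction e with | _ m p
    induction f with | _ q r
    by_contra! hcon
    simp only [Sym2.mk_isDiag_iff, Sym2.mem_iff] at h₁ h₂ hcon
    exact hyp a b c m p q r habc.1 habc.2.1 habc.2.2 h₁ (by grind) (by grind) (by grind)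
      (by grind) h₂ hsum
  exact ⟨π, fun i j hij => by rw [hφ _ (by simpa using hij), hπ i j hij]⟩
end

section
/- Let d be a positive integer and let G be a graph with n ≥ 5 nodes, with node weights w_i = (w¹_i,…,w^d_i) ∈ ℝ^d and no edge weights. Suppose that for every pairwise distinct i, j, k ∈ {1,…,n}, every pairwise distinct m, p, q, r ∈ {1,…,n}, and every l = 1,…,d−1: w^l_i + w^l_j + w^{l+1}_j + w^{l+1}_k ≠ w^l_m + w^l_p + w^{l+1}_q + w^{l+1}_r. Then G is reconstructible from the following 2d−1 one-dimensional distributions: D_{w^l}(G) for l = 1,…,d, and D_{β^{l,l+1}}(G) for l = 1,…,d−1. That is, every graph G' with n nodes and node weights in ℝ^d for which all these distributions agree with those of G is isomorphic to G. -/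
/-- The multiset of (scalar) node weights `v i` over the nodes `i`. -/
def nodeWeightDist {n : ℕ} {X : Type*} (v : Fin n → X) : Multiset X :=
  (Finset.univ : Finset (Fin n)).val.map v

/-- The multiset of the quantities `u i + u j + v j + v k` over triples of
pairwise distinct `i, j, k`; with `u = w^l` and `v = w^{l+1}` this is the
distribution of the `β^{l,l+1}_{i,j,k}`. -/
def betaDist {n : ℕ} {X : Type*} [Add X] (u v : Fin n → X) : Multiset X :=
  ((Finset.univ : Finset (Fin n × Fin n × Fin n)).filter
      (fun p => p.1 ≠ p.2.1 ∧ p.2.1 ≠ p.2.2 ∧ p.1 ≠ p.2.2)).val.map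
    (fun p => u p.1 + u p.2.1 + v p.2.1 + v p.2.2)

/-- Two graphs with node weights (and no edge weights) are isomorphic if there
is a permutation `π` of the nodes with `w' i = w (π i)` for all `i`. -/
def NodeGraphIso {n : ℕ} {X : Type*} (w w' : Fin n → X) : Prop :=
  ∃ π : Equiv.Perm (Fin n), ∀ i : Fin n, w' i = w (π i)

/-- Two families with the same multiset of values differ by a permutation of the indices. -/
lemma exists_eq_comp_perm_of_nodeWeightDist_eq {n : ℕ} {X : Type*} {u v : Fin n → X}
    (h : nodeWeightDist u = nodeWeightDist v) : ∃ σ : Equiv.Perm (Fin n), u = v ∘ σ := by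
  classical
  have hcard (x : X) : Fintype.card {i // u i = x} = Fintype.card {i // v i = x} := by
    have := congrArg (Multiset.count x) h
    simp only [nodeWeightDist, Multiset.count_map, eq_comm (a := x)] at this
    rw [Fintype.card_subtype, Fintype.card_subtype]
    exact this
  refine ⟨Equiv.ofFiberEquiv fun x => Fintype.equivOfCardEq (hcard x), funext fun i => ?_⟩
  exact (Equiv.ofFiberEquiv_map _ i).symm

/-- A permutation `φ` of at least five points is the identity as soon as
`{a, b}` meets `{φ b, φ c}` for all pairwise distinct `a, b, c`. -/
lemma perm_eq_one_of_forall_not_disjoint {n : ℕ} (hn : 5 ≤ n) (φ : Equiv.Perm (Fin n))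
    (h : ∀ a b c : Fin n, a ≠ b → b ≠ c → a ≠ c →
      φ b = a ∨ φ b = b ∨ φ c = a ∨ φ c = b) : φ = 1 := by
  have exists_notMem (s : Finset (Fin n)) (hs : s.card ≤ 4) : ∃ x, x ∉ s := by
    by_contra! hx
    have := Finset.card_le_card (fun x _ => hx x : Finset.univ ⊆ s)
    simp only [Finset.card_univ, Fintype.card_fin] at this
    omega
  ext1 b
  by_contra hb
  obtain ⟨c, hc⟩ := exists_notMem {b, φ.symm b} (Finset.card_le_two.trans (by norm_num))
  obtain ⟨a, ha⟩ := exists_notMem {b, c, φ b, φ c} Finset.card_le_four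
  simp only [Finset.mem_insert, Finset.mem_singleton, not_or] at hc ha
  rcases h a b c ha.1 (Ne.symm hc.1) ha.2.1 with h | h | h | h
  · exact ha.2.2.1 h.symm
  · exact hb h
  · exact ha.2.2.2 h.symm
  · exact hc.2 (φ.eq_symm_apply.mpr h)

/-- Under the genericity condition, a permutation matching the first components of two
node-weighted graphs also matches the second ones. -/
lemma eq_comp_perm_of_betaDist_eq {n : ℕ} {X : Type*} [Add X] (hn : 5 ≤ n)
    {u v u' v' : Fin n → X}
    (hyp : ∀ i j k m p q r : Fin n,
      i ≠ j → j ≠ k → i ≠ k →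
      m ≠ p → m ≠ q → m ≠ r → p ≠ q → p ≠ r → q ≠ r →
        u i + u j + v j + v k ≠ u m + u p + v q + v r)
    (hv : nodeWeightDist v' = nodeWeightDist v) (hβ : betaDist u' v' = betaDist u v)
    {σ : Equiv.Perm (Fin n)} (hσ : u' = u ∘ σ) : v' = v ∘ σ := by
  obtain ⟨τ, hτ⟩ := exists_eq_comp_perm_of_nodeWeightDist_eq hv
  suffices h : σ.symm.trans τ = 1 by
    funext i
    simpa [hτ] using congrArg v (Equiv.congr_fun h (σ i))
  refine perm_eq_one_of_forall_not_disjoint hn _ fun a b c hab hbc hac => ?_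
  by_contra! hne
  have hmem : u a + u b + v (τ (σ.symm b)) + v (τ (σ.symm c)) ∈ betaDist u' v' :=
    Multiset.mem_map.mpr ⟨(σ.symm a, σ.symm b, σ.symm c), by simp [*], by simp [hσ, hτ]⟩
  rw [hβ] at hmem
  obtain ⟨⟨i, j, k⟩, hijk, heq⟩ := Multiset.mem_map.mp hmem
  simp only [Finset.mem_val, Finset.mem_filter, Finset.mem_univ, true_and] at hijk
  exact hyp i j k a b _ _ hijk.1 hijk.2.1 hijk.2.2 hab hne.1.symm hne.2.2.1.symm
    hne.2.1.symm hne.2.2.2.symm (by simpa using hbc) heq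

/-- A graph with `n ≥ 5` nodes, node weights in `ℝ^d` and no edge weights,
satisfying the genericity condition for consecutive components, is
reconstructible from the `2d - 1` one-dimensional distributions `D_{w^l}`
(`l = 1,…,d`) and `D_{β^{l,l+1}}` (`l = 1,…,d-1`). -/
theorem reconstructible_node_weights {n d : ℕ} (hn : 5 ≤ n) (hd : 0 < d)
    (w : Fin n → (Fin d → ℝ))
    (hyp : ∀ i j k m p q r : Fin n,
      i ≠ j → j ≠ k → i ≠ k →
      m ≠ p → m ≠ q → m ≠ r → p ≠ q → p ≠ r → q ≠ r →
      ∀ (l : Fin d) (hl : l.val + 1 < d),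
        w i l + w j l + w j ⟨l.val + 1, hl⟩ + w k ⟨l.val + 1, hl⟩ ≠
          w m l + w p l + w q ⟨l.val + 1, hl⟩ + w r ⟨l.val + 1, hl⟩) :
    ∀ w' : Fin n → (Fin d → ℝ),
      (∀ l : Fin d,
        nodeWeightDist (fun i => w' i l) = nodeWeightDist (fun i => w i l)) →
      (∀ (l : Fin d) (hl : l.val + 1 < d),
        betaDist (fun i => w' i l) (fun i => w' i ⟨l.val + 1, hl⟩) =
          betaDist (fun i => w i l) (fun i => w i ⟨l.val + 1, hl⟩)) →
      NodeGraphIso w w' := by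
  intro w' hw hβ
  obtain ⟨σ, hσ⟩ := exists_eq_comp_perm_of_nodeWeightDist_eq (hw ⟨0, hd⟩)
  have hall : ∀ (l : ℕ) (hl : l < d), (fun i => w' i ⟨l, hl⟩) = (fun i => w i ⟨l, hl⟩) ∘ σ := by
    intro l
    induction l with
    | zero => exact fun _ => hσ
    | succ l ih =>
      intro hl
      exact eq_comp_perm_of_betaDist_eq hn
        (fun i j k m p q r h₁ h₂ h₃ h₄ h₅ h₆ h₇ h₈ h₉ =>
          hyp i j k m p q r h₁ h₂ h₃ h₄ h₅ h₆ h₇ h₈ h₉ ⟨l, by omega⟩ hl)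
        (hw _) (hβ ⟨l, by omega⟩ hl) (ih (by omega))
  exact ⟨σ, fun i => funext fun l => congrFun (hall l l.isLt) i⟩
end
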